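/- Let ℤ₄ = ℤ/4ℤ, let Xℤ₄[X] be the additive group of polynomials over ℤ₄ with zero constant term, let H be the additive subgroup {2p(X²) − 2p(X) : p ∈ Xℤ₄[X]} (the image of the additive homomorphism p(X) ↦ 2p(X²) − 2p(X)), and let G = Xℤ₄[X]/H. Then the class of the polynomial X in G has additive order exactly 4; in particular 2·[X] ≠ 0 in G. -/

import Mathlib

open Polynomial

/-- The additive group `Xℤ₄[X]` of polynomials over `ℤ₄ = ℤ/4ℤ` with zero constant
term, as an additive subgroup of `ℤ₄[X]`. -/
noncomputable def Xpoly4 : AddSubgroup (Polynomial (ZMod 4)) where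
  carrier := {f | f.coeff 0 = 0}
  zero_mem' := by simp
  add_mem' := by
    intro a b ha hb
    simp only [Set.mem_setOf_eq, coeff_add] at *
    simp [ha, hb]
  neg_mem' := by
    intro a ha
    simp only [Set.mem_setOf_eq, coeff_neg] at *
    simp [ha]

/-- The additive subgroup `H = {2p(X²) − 2p(X) : p ∈ Xℤ₄[X]}` of `Xℤ₄[X]`, the image of
the additive homomorphism `p(X) ↦ 2p(X²) − 2p(X)`. -/
noncomputable def Hsub : AddSubgroup Xpoly4 where
  carrier := {q | ∃ p : Polynomial (ZMod 4), p.coeff 0 = 0 ∧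
    (q : Polynomial (ZMod 4)) = 2 * p.comp (X ^ 2) - 2 * p}
  zero_mem' := ⟨0, by simp⟩
  add_mem' := by
    rintro a b ⟨p, hp, hp2⟩ ⟨q, hq, hq2⟩
    refine ⟨p + q, by simp [coeff_add, hp, hq], ?_⟩
    push_cast [hp2, hq2, add_comp]
    ring
  neg_mem' := by
    rintro a ⟨p, hp, hp2⟩
    refine ⟨-p, by simp [coeff_neg, hp], ?_⟩
    push_cast [hp2, neg_comp]
    ring

/-- The quotient group `G = Xℤ₄[X]/H` of the Connolly–Davis computation. -/
abbrev G12 : Type := Xpoly4 ⧸ Hsub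

/-- The class of the polynomial `X` in `G12`. -/
noncomputable def classX : G12 :=
  QuotientAddGroup.mk (⟨X, coeff_X_zero⟩ : Xpoly4)

/-- The order of `2 • [X]` is detected by evaluation at `1`, which vanishes on `Hsub`. -/
theorem two_nsmul_classX_ne_zero : 2 • classX ≠ 0 := by
  intro h
  obtain ⟨p, -, hp⟩ : 2 • (⟨X, coeff_X_zero⟩ : Xpoly4) ∈ Hsub :=
    (QuotientAddGroup.eq_zero_iff _).mp h
  have h2 : (2 : ZMod 4) = 0 := by
    simpa [two_nsmul, two_mul, one_add_one_eq_two] using congrArg (eval 1) hp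
  exact absurd h2 (by decide)

theorem four_nsmul_classX : 4 • classX = 0 := by
  have h : 4 • (⟨X, coeff_X_zero⟩ : Xpoly4) = 0 :=
    Subtype.ext <| (nsmul_eq_mul 4 (X : (ZMod 4)[X])).trans <| by
      rw [CharP.cast_eq_zero (ZMod 4)[X] 4, zero_mul]; rfl
  exact congrArg (QuotientAddGroup.mk (s := Hsub)) h

/-- In `G = Xℤ₄[X]/{2p(X²) − 2p(X)}`, the class of the polynomial `X` has additive order
exactly `4`; in particular `2·[X] ≠ 0`. -/
theorem addOrderOf_classX_eq_four :
    addOrderOf classX = 4 ∧ 2 • classX ≠ 0 := by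
  have : Fact (Nat.Prime 2) := ⟨Nat.prime_two⟩
  exact ⟨addOrderOf_eq_prime_pow (p := 2) (n := 1) two_nsmul_classX_ne_zero four_nsmul_classX,
    two_nsmul_classX_ne_zero⟩
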